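/- arXiv:2506.12640 — 8 statements merged into one kernel-verified Lean document; each statement's English description precedes it below -/
import Mathlib

section
/- Let X₀, X₁ ∈ M₂(ℂ) with X₀ hermitian. Then the matrix exp(−2πiφ)·X₁* + X₀ + exp(2πiφ)·X₁ is an idempotent for every φ ∈ ℝ if and only if the three equations X₁² = 0, X₁ = X₀X₁ + X₁X₀, and X₀ = X₀² + X₁*X₁ + X₁X₁* hold. (When these hold, each such matrix is automatically self-adjoint, i.e. a projection.) -/
open Matrix

/-- The Rieffel family associated to a pair of 2×2 complex matrices. -/
noncomputable def rieffelP (X₀ X₁ : Matrix (Fin 2) (Fin 2) ℂ) (φ : ℝ) :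
    Matrix (Fin 2) (Fin 2) ℂ :=
  Complex.exp (-(((2 * Real.pi * φ : ℝ) : ℂ) * Complex.I)) • X₁ᴴ + X₀ +
    Complex.exp (((2 * Real.pi * φ : ℝ) : ℂ) * Complex.I) • X₁

lemma rieffel_expand (Y X₀ X₁ : Matrix (Fin 2) (Fin 2) ℂ) (v w : ℂ) :
    (v • Y + X₀ + w • X₁) * (v • Y + X₀ + w • X₁) - (v • Y + X₀ + w • X₁) =
      (v * v) • (Y * Y) + v • (X₀ * Y + Y * X₀ - Y) + (X₀ * X₀ - X₀)
      + (w * v) • (Y * X₁ + X₁ * Y) + w • (X₀ * X₁ + X₁ * X₀ - X₁) + (w * w) • (X₁ * X₁) := by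
  simp only [add_mul, mul_add, smul_mul_assoc, mul_smul_comm]
  module

lemma rieffel_exp_mul (z : ℂ) : Complex.exp z * Complex.exp (-z) = 1 := by
  rw [← Complex.exp_add]; simp

lemma rieffel_coeff (A A' B B' C : Matrix (Fin 2) (Fin 2) ℂ)
    (h : ∀ φ : ℝ, ∀ v w : ℂ, v = Complex.exp (-(((2 * Real.pi * φ : ℝ) : ℂ) * Complex.I)) →
      w = Complex.exp (((2 * Real.pi * φ : ℝ) : ℂ) * Complex.I) →
      (v * v) • A' + v • B' + C + w • B + (w * w) • A = 0) : A = 0 ∧ B = 0 ∧ C = 0 := by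
  have hI := Complex.I_mul_I
  have e4 : Complex.exp (((2 * Real.pi * (1/4) : ℝ) : ℂ) * Complex.I) = Complex.I := by
    refine Eq.trans ?_ Complex.exp_pi_div_two_mul_I; congr 1; push_cast; ring
  have e4' : Complex.exp (-(((2 * Real.pi * (1/4) : ℝ) : ℂ) * Complex.I)) = -Complex.I := by
    rw [Complex.exp_neg, e4, Complex.inv_I]
  have e2 : Complex.exp (((2 * Real.pi * (1/2) : ℝ) : ℂ) * Complex.I) = -1 := by
    rw [← Complex.exp_pi_mul_I]; congr 1; push_cast; ring
  have e2' : Complex.exp (-(((2 * Real.pi * (1/2) : ℝ) : ℂ) * Complex.I)) = -1 := by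
    rw [Complex.exp_neg, e2]; norm_num
  have e3 : Complex.exp (((2 * Real.pi * (-(1/4)) : ℝ) : ℂ) * Complex.I) = -Complex.I := by
    rw [← e4']; congr 1; push_cast; ring
  have e3' : Complex.exp (-(((2 * Real.pi * (-(1/4)) : ℝ) : ℂ) * Complex.I)) = Complex.I := by
    refine Eq.trans ?_ e4; congr 1; push_cast; ring
  have h0 := h 0 1 1 (by simp) (by simp)
  have h2 := h (1/2) _ _ e2'.symm e2.symm
  have h4 := h (1/4) _ _ e4'.symm e4.symm
  have h3 := h (-(1/4)) _ _ e3'.symm e3.symm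
  have h8 := h (1/8) _ _ rfl rfl
  have e8 : Complex.exp (((2 * Real.pi * (1/8) : ℝ) : ℂ) * Complex.I) *
      Complex.exp (((2 * Real.pi * (1/8) : ℝ) : ℂ) * Complex.I) = Complex.I := by
    rw [← Complex.exp_add]; refine Eq.trans ?_ e4; congr 1; push_cast; ring
  have e8' : Complex.exp (-(((2 * Real.pi * (1/8) : ℝ) : ℂ) * Complex.I)) *
      Complex.exp (-(((2 * Real.pi * (1/8) : ℝ) : ℂ) * Complex.I)) = -Complex.I := by
    rw [← Complex.exp_add, ← e4']; congr 1; push_cast; ring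
  rw [e8, e8'] at h8
  simp only [neg_mul_neg, hI, one_mul] at h0 h2 h4 h3
  have hC : C = 0 := by
    linear_combination (norm := module) (1/4 : ℂ) • h0 + (1/4 : ℂ) • h2 + (1/4 : ℂ) • h3 + (1/4 : ℂ) • h4
  have hA : A + A' = 0 := by
    linear_combination (norm := module) (1/4 : ℂ) • h0 + (1/4 : ℂ) • h2 - (1/4 : ℂ) • h3 - (1/4 : ℂ) • h4
  have hB1 : B + B' = 0 := by
    linear_combination (norm := module) (1/2 : ℂ) • h0 - (1/2 : ℂ) • h2
  have hB2' : Complex.I • (B - B') = 0 := by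
    linear_combination (norm := module) (1/2 : ℂ) • h4 - (1/2 : ℂ) • h3
  have hB2 : B - B' = 0 := (smul_eq_zero.mp hB2').resolve_left Complex.I_ne_zero
  have hB : B = 0 := by
    linear_combination (norm := module) (1/2 : ℂ) • hB1 + (1/2 : ℂ) • hB2
  have hB' : B' = 0 := by
    linear_combination (norm := module) (1/2 : ℂ) • hB1 - (1/2 : ℂ) • hB2
  rw [hB, hB', hC] at h8
  have hA2' : Complex.I • (A - A') = 0 := by
    simp only [smul_zero, add_zero] at h8
    linear_combination (norm := module) h8
  have hA2 : A - A' = 0 := (smul_eq_zero.mp hA2').resolve_left Complex.I_ne_zero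
  refine ⟨?_, hB, hC⟩
  linear_combination (norm := module) (1/2 : ℂ) • hA + (1/2 : ℂ) • hA2

theorem stmt0 (X₀ X₁ : Matrix (Fin 2) (Fin 2) ℂ) (hX₀ : X₀.IsHermitian) :
    ((∀ φ : ℝ, rieffelP X₀ X₁ φ * rieffelP X₀ X₁ φ = rieffelP X₀ X₁ φ) ↔
      (X₁ * X₁ = 0 ∧ X₁ = X₀ * X₁ + X₁ * X₀ ∧ X₀ = X₀ * X₀ + X₁ᴴ * X₁ + X₁ * X₁ᴴ)) ∧
    ((X₁ * X₁ = 0 ∧ X₁ = X₀ * X₁ + X₁ * X₀ ∧ X₀ = X₀ * X₀ + X₁ᴴ * X₁ + X₁ * X₁ᴴ) →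
      ∀ φ : ℝ, (rieffelP X₀ X₁ φ)ᴴ = rieffelP X₀ X₁ φ) := by
  refine ⟨⟨fun h => ?_, ?_⟩, ?_⟩
  · obtain ⟨hA, hB, hC⟩ := rieffel_coeff (X₁ * X₁) (X₁ᴴ * X₁ᴴ) (X₀ * X₁ + X₁ * X₀ - X₁)
      (X₀ * X₁ᴴ + X₁ᴴ * X₀ - X₁ᴴ) (X₀ * X₀ - X₀ + (X₁ᴴ * X₁ + X₁ * X₁ᴴ)) (by
        intro φ v w hv hw
        have hwv : w * v = 1 := by rw [hv, hw]; exact rieffel_exp_mul _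
        have h1 := h φ
        unfold rieffelP at h1
        rw [← hv, ← hw] at h1
        have h2 := rieffel_expand X₁ᴴ X₀ X₁ v w
        rw [h1, sub_self, hwv, one_smul] at h2
        rw [h2]
        abel)
    refine ⟨hA, (sub_eq_zero.mp hB).symm, ?_⟩
    rw [← sub_eq_zero, ← neg_eq_zero, ← hC]
    abel
  · rintro ⟨hA, hB, hC⟩ φ
    rw [← sub_eq_zero]
    unfold rieffelP
    rw [rieffel_expand, rieffel_exp_mul]
    have hA' : X₁ᴴ * X₁ᴴ = 0 := by rw [← conjTranspose_mul, hA, conjTranspose_zero]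
    have hB' : X₀ * X₁ᴴ + X₁ᴴ * X₀ - X₁ᴴ = 0 := by
      have h1 := congrArg conjTranspose hB
      rw [conjTranspose_add, conjTranspose_mul, conjTranspose_mul, hX₀.eq] at h1
      rw [sub_eq_zero, add_comm]
      exact h1.symm
    have hC' : X₀ * X₀ - X₀ + (X₁ᴴ * X₁ + X₁ * X₁ᴴ) = 0 := by
      rw [← neg_eq_zero, ← sub_eq_zero.mpr hC]
      abel
    rw [hA, hA', hB', ← hB, sub_self, one_smul]
    simpa using hC'
  · rintro - φ
    unfold rieffelP
    rw [conjTranspose_add, conjTranspose_add, conjTranspose_smul, conjTranspose_smul,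
      conjTranspose_conjTranspose, hX₀.eq]
    simp only [Complex.star_def, ← Complex.exp_conj, map_neg, map_mul, Complex.conj_ofReal,
      Complex.conj_I, mul_neg, neg_neg]
    abel
end

section
/- If X ∈ M₂(ℂ) satisfies X² = 0, then X*X + XX* = tr(X*X)·1₂, where 1₂ is the 2×2 identity matrix. -/
open Matrix

theorem stmt5 (X : Matrix (Fin 2) (Fin 2) ℂ) (hX : X ^ 2 = 0) :
    Xᴴ * X + X * Xᴴ = (Xᴴ * X).trace • (1 : Matrix (Fin 2) (Fin 2) ℂ) := by
  have h00 := congrFun (congrFun hX 0) 0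
  have h01 := congrFun (congrFun hX 0) 1
  have h10 := congrFun (congrFun hX 1) 0
  have h11 := congrFun (congrFun hX 1) 1
  simp only [pow_two, Matrix.mul_apply, Fin.sum_univ_two, Matrix.zero_apply] at h00 h01 h10 h11
  have hd : X 1 1 = - X 0 0 := by
    by_contra hne
    have hs : X 0 0 + X 1 1 ≠ 0 := fun h => hne (by linear_combination h)
    have hb : X 0 1 = 0 := by
      apply (mul_eq_zero.mp (_ : X 0 1 * (X 0 0 + X 1 1) = 0)).resolve_right hs
      linear_combination h01
    have ha : X 0 0 = 0 := by
      apply mul_self_eq_zero.mp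
      linear_combination h00 - X 1 0 * hb
    have hd : X 1 1 = 0 := by
      apply mul_self_eq_zero.mp
      linear_combination h11 - X 1 0 * hb
    exact hs (by rw [ha, hd, add_zero])
  ext i j
  fin_cases i <;> fin_cases j <;>
    simp [Matrix.mul_apply, Fin.sum_univ_two, Matrix.trace, hd] <;> ring
end

section
/- Let Y be a compact Hausdorff topological space and let X₀, X₁ : Y → M₂(ℂ) be continuous with X₀(y) hermitian for every y, satisfying pointwise the Rieffel equations X₁² = 0, X₁ = X₀X₁ + X₁X₀, X₀ = X₀² + X₁*X₁ + X₁X₁*, with tr(X₀(y)) = 1 for all y and X₁ not identically zero. Let supp(X₁) = {y ∈ Y : X₁(y) ≠ 0}, and for each y let ℓ(y) ∈ M₂(ℂ) be the orthogonal projection of ℂ² onto the column space of X₁(y) (so ℓ(y) = 0 when X₁(y) = 0). Then there exists a function f : Y → [0,1] such that: f is continuous on supp(X₁) and vanishes on Y ∖ supp(X₁); X₀(y)·ℓ(y) = f(y)·ℓ(y) for every y ∈ Y (in particular X₀(y) commutes with ℓ(y)); and the function y ↦ exp(2πi f(y)) is continuous on Y. -/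
open Matrix

lemma aux_trace (N : Matrix (Fin 2) (Fin 2) ℂ) (h : N * N = 0) :
    N 1 1 = - N 0 0 ∧ N 0 0 * N 0 0 + N 0 1 * N 1 0 = 0 := by
  have h00 := congrFun (congrFun h 0) 0
  have h01 := congrFun (congrFun h 0) 1
  have h10 := congrFun (congrFun h 1) 0
  have h11 := congrFun (congrFun h 1) 1
  simp only [Matrix.mul_apply, Fin.sum_univ_two, Matrix.zero_apply] at h00 h01 h10 h11
  refine ⟨?_, h00⟩
  by_contra hne
  have hs : N 0 0 + N 1 1 ≠ 0 := fun h' => hne (by linear_combination h')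
  have hq : N 0 1 = 0 := by
    have : N 0 1 * (N 0 0 + N 1 1) = 0 := by linear_combination h01
    exact (mul_eq_zero.mp this).resolve_right hs
  have hp : N 0 0 = 0 := by simpa [hq] using h00
  have ht : N 1 1 = 0 := by simpa [hq] using h11
  exact hne (by rw [hp, ht]; simp)

lemma aux_sum (N : Matrix (Fin 2) (Fin 2) ℂ) (h : N * N = 0) :
    N * Nᴴ + Nᴴ * N = (Nᴴ * N).trace • (1 : Matrix (Fin 2) (Fin 2) ℂ) := by
  obtain ⟨ht, hd⟩ := aux_trace N h
  ext i j
  fin_cases i <;> fin_cases j <;>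
    simp [Matrix.mul_apply, Fin.sum_univ_two, Matrix.trace, ht] <;> ring

lemma aux_nmn (N M : Matrix (Fin 2) (Fin 2) ℂ) (h : N * N = 0) :
    N * M * N = (M * N).trace • N := by
  obtain ⟨ht, hd⟩ := aux_trace N h
  ext i j
  fin_cases i <;> fin_cases j <;>
    simp [Matrix.mul_apply, Fin.sum_univ_two, Matrix.trace, ht]
  · linear_combination (M 1 1) * hd
  · linear_combination (-M 0 1) * hd
  · linear_combination (-M 1 0) * hd
  · linear_combination (M 0 0) * hd

lemma aux_main (A N : Matrix (Fin 2) (Fin 2) ℂ) (h : N * N = 0)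
    (h2 : N = A * N + N * A) :
    (Nᴴ * N).trace • (A * N) = (Nᴴ * A * N).trace • N := by
  have h0 : N * A * N = 0 := by
    have := congrArg (fun Z => N * Z) h2
    simp only [Matrix.mul_add, ← Matrix.mul_assoc, h, Matrix.zero_mul, add_zero] at this
    exact this.symm
  have h1 : (N * Nᴴ + Nᴴ * N) * (A * N) = (Nᴴ * N).trace • (A * N) := by
    rw [aux_sum N h]; simp
  rw [← h1, Matrix.add_mul, ← aux_nmn N (Nᴴ * A) h]
  have : Nᴴ * N * (A * N) = Nᴴ * (N * A * N) := by simp only [Matrix.mul_assoc]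
  rw [this, h0, Matrix.mul_zero, add_zero]
  simp only [Matrix.mul_assoc]

lemma aux_s (N : Matrix (Fin 2) (Fin 2) ℂ) :
    ∃ s : ℝ, 0 ≤ s ∧ (Nᴴ * N).trace = s ∧ (s = 0 → N = 0) := by
  refine ⟨Complex.normSq (N 0 0) + Complex.normSq (N 1 0) + Complex.normSq (N 0 1)
    + Complex.normSq (N 1 1), ?_, ?_, ?_⟩
  · have := Complex.normSq_nonneg
    linarith [this (N 0 0), this (N 1 0), this (N 0 1), this (N 1 1)]
  · simp [Matrix.trace, Matrix.mul_apply, Fin.sum_univ_two, Complex.normSq_eq_conj_mul_self]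
    ring
  · intro hs
    have := Complex.normSq_nonneg
    have a1 := this (N 0 0)
    have a2 := this (N 0 1)
    have a3 := this (N 1 0)
    have a4 := this (N 1 1)
    have b1 : N 0 0 = 0 := Complex.normSq_eq_zero.mp (by linarith)
    have b2 : N 0 1 = 0 := Complex.normSq_eq_zero.mp (by linarith)
    have b3 : N 1 0 = 0 := Complex.normSq_eq_zero.mp (by linarith)
    have b4 : N 1 1 = 0 := Complex.normSq_eq_zero.mp (by linarith)
    ext i j
    fin_cases i <;> fin_cases j <;> simp [b1, b2, b3, b4]

lemma aux_point (A N : Matrix (Fin 2) (Fin 2) ℂ) (hA : A.IsHermitian) (h : N * N = 0)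
    (h2 : N = A * N + N * A) (h3 : A = A * A + Nᴴ * N + N * Nᴴ) (f : ℝ)
    (hf : f = (Nᴴ * A * N).trace.re / (Nᴴ * N).trace.re) :
    A * N = (f : ℂ) • N ∧ f * (1 - f) = (Nᴴ * N).trace.re := by
  obtain ⟨s, hs, hst, hs0⟩ := aux_s N
  have hre : (((Nᴴ * A * N).trace.re : ℝ) : ℂ) = (Nᴴ * A * N).trace := by
    apply Complex.conj_eq_iff_re.mp
    have : (Nᴴ * A * N)ᴴ = Nᴴ * A * N := by
      simp [Matrix.conjTranspose_mul, hA.eq, Matrix.mul_assoc]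
    have h' := Matrix.trace_conjTranspose (Nᴴ * A * N)
    rw [this] at h'
    exact h'.symm
  by_cases hz : s = 0
  · have hN := hs0 hz
    subst hN
    simp at hf
    simp [hf]
  · have hm := aux_main A N h h2
    rw [hst, ← hre] at hm
    rw [hst, Complex.ofReal_re] at hf
    have hsc : (s : ℂ) ≠ 0 := by exact_mod_cast hz
    have hAN : A * N = (f : ℂ) • N := by
      have : (s : ℂ) • (A * N) = (s : ℂ) • ((f : ℂ) • N) := by
        rw [hm, smul_smul, hf]
        congr 1
        push_cast
        field_simp
      exact smul_right_injective _ hsc this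
    refine ⟨hAN, ?_⟩
    have hN : N ≠ 0 := by
      rintro rfl
      simp at hst
      exact hz (by exact_mod_cast hst.symm)
    have h4 : A = A * A + (s : ℂ) • (1 : Matrix (Fin 2) (Fin 2) ℂ) := by
      rw [← hst, ← aux_sum N h, add_comm (N * Nᴴ), ← add_assoc]
      exact h3
    have h5 := congrArg (fun Z => Z * N) h4
    simp only [Matrix.add_mul, Matrix.mul_assoc, hAN, Matrix.mul_smul, Matrix.smul_mul,
      Matrix.one_mul, smul_smul, ← add_smul] at h5
    have h6 := smul_left_injective ℂ hN h5
    rw [hst, Complex.ofReal_re]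
    have h7 : f = f * f + s := by exact_mod_cast h6
    linarith

lemma aux_factor (L N : Matrix (Fin 2) (Fin 2) ℂ)
    (h : LinearMap.range L.mulVecLin = LinearMap.range N.mulVecLin) :
    ∃ K : Matrix (Fin 2) (Fin 2) ℂ, L = N * K := by
  have : ∀ j : Fin 2, ∃ v : Fin 2 → ℂ, N *ᵥ v = L *ᵥ (Pi.single j 1) := by
    intro j
    have hj : L.mulVecLin (Pi.single j 1) ∈ LinearMap.range N.mulVecLin := by
      rw [← h]; exact ⟨_, rfl⟩
    obtain ⟨v, hv⟩ := hj
    exact ⟨v, hv⟩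
  choose k hk using this
  refine ⟨Matrix.of fun i j => k j i, ?_⟩
  ext i j
  have := congrFun (hk j) i
  rw [Matrix.mulVec_single_one] at this
  simpa [Matrix.mul_apply, Matrix.mulVec, dotProduct] using this.symm

lemma aux_exp (t : ℝ) (h0 : 0 ≤ t) (h1 : t ≤ 1) :
    ‖Complex.exp (((2 * Real.pi * t : ℝ) : ℂ) * Complex.I) - 1‖ ≤ 4 * Real.pi * (t * (1 - t)) := by
  have hpi := Real.pi_pos
  have key : ∀ x : ℝ, ‖Complex.exp ((x : ℂ) * Complex.I) - 1‖ ≤ |x| := by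
    intro x
    have := Real.norm_exp_I_mul_ofReal_sub_one_le (x := x)
    rw [mul_comm]
    simpa using this
  rcases le_total t (1/2) with ht | ht
  · refine (key _).trans ?_
    rw [abs_of_nonneg (by positivity)]
    have : 0 ≤ Real.pi * (t * (1 - 2 * t)) := by
      apply mul_nonneg hpi.le (mul_nonneg h0 (by linarith))
    nlinarith
  · have e : Complex.exp (((2 * Real.pi * t : ℝ) : ℂ) * Complex.I)
        = Complex.exp (((2 * Real.pi * (t - 1) : ℝ) : ℂ) * Complex.I) := by
      rw [← Complex.exp_periodic (((2 * Real.pi * (t - 1) : ℝ) : ℂ) * Complex.I)]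
      congr 1
      push_cast
      ring
    rw [e]
    refine (key _).trans ?_
    rw [abs_of_nonpos (by nlinarith)]
    have : 0 ≤ Real.pi * ((1 - t) * (2 * t - 1)) := by
      apply mul_nonneg hpi.le (mul_nonneg (by linarith) (by linarith))
    nlinarith

theorem stmt10 {Y : Type*} [TopologicalSpace Y] [CompactSpace Y] [T2Space Y]
    (X₀ X₁ : Y → Matrix (Fin 2) (Fin 2) ℂ)
    (hX₀c : Continuous X₀) (hX₁c : Continuous X₁)
    (hherm : ∀ y, (X₀ y).IsHermitian)
    (heq1 : ∀ y, X₁ y * X₁ y = 0)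
    (heq2 : ∀ y, X₁ y = X₀ y * X₁ y + X₁ y * X₀ y)
    (heq3 : ∀ y, X₀ y = X₀ y * X₀ y + (X₁ y)ᴴ * X₁ y + X₁ y * (X₁ y)ᴴ)
    (htr : ∀ y, (X₀ y).trace = 1)
    (hne : ∃ y, X₁ y ≠ 0)
    (ℓ : Y → Matrix (Fin 2) (Fin 2) ℂ)
    -- `ℓ y` is the orthogonal projection onto the column space of `X₁ y`:
    (hℓherm : ∀ y, (ℓ y)ᴴ = ℓ y) (hℓidem : ∀ y, ℓ y * ℓ y = ℓ y)
    (hℓrange : ∀ y, LinearMap.range (ℓ y).mulVecLin = LinearMap.range (X₁ y).mulVecLin) :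
    ∃ f : Y → ℝ,
      (∀ y, f y ∈ Set.Icc (0 : ℝ) 1) ∧
      ContinuousOn f {y | X₁ y ≠ 0} ∧
      (∀ y ∉ {y | X₁ y ≠ 0}, f y = 0) ∧
      (∀ y, X₀ y * ℓ y = (f y : ℂ) • ℓ y) ∧
      (∀ y, X₀ y * ℓ y = ℓ y * X₀ y) ∧
      Continuous fun y => Complex.exp (((2 * Real.pi * f y : ℝ) : ℂ) * Complex.I) := by
  obtain ⟨f, hf⟩ : ∃ f : Y → ℝ, ∀ y, f y =
      ((X₁ y)ᴴ * X₀ y * X₁ y).trace.re / ((X₁ y)ᴴ * X₁ y).trace.re := ⟨_, fun _ => rfl⟩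
  have hp := fun y => aux_point (X₀ y) (X₁ y) (hherm y) (heq1 y) (heq2 y) (heq3 y) (f y) (hf y)
  have hsnn : ∀ y, 0 ≤ ((X₁ y)ᴴ * X₁ y).trace.re := by
    intro y
    obtain ⟨s, hs, hst, -⟩ := aux_s (X₁ y)
    rw [hst]; simpa using hs
  have hsne : ∀ y, X₁ y ≠ 0 → ((X₁ y)ᴴ * X₁ y).trace.re ≠ 0 := by
    intro y hy
    obtain ⟨s, hs, hst, h0⟩ := aux_s (X₁ y)
    rw [hst]
    intro h
    exact hy (h0 (by simpa using h))
  have hsc : Continuous fun y => ((X₁ y)ᴴ * X₁ y).trace.re :=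
    Complex.continuous_re.comp ((hX₁c.matrix_conjTranspose.matrix_mul hX₁c).matrix_trace)
  have hnc : Continuous fun y => ((X₁ y)ᴴ * X₀ y * X₁ y).trace.re :=
    Complex.continuous_re.comp
      (((hX₁c.matrix_conjTranspose.matrix_mul hX₀c).matrix_mul hX₁c).matrix_trace)
  have hIcc : ∀ y, f y ∈ Set.Icc (0 : ℝ) 1 := by
    intro y
    have h1 := (hp y).2
    have h2 := hsnn y
    rw [← h1] at h2
    constructor <;> nlinarith
  have hcont : ContinuousOn f {y | X₁ y ≠ 0} := by
    have : f = fun y => ((X₁ y)ᴴ * X₀ y * X₁ y).trace.re / ((X₁ y)ᴴ * X₁ y).trace.re := funext hf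
    rw [this]
    exact hnc.continuousOn.div hsc.continuousOn hsne
  have hzero : ∀ y ∉ {y | X₁ y ≠ 0}, f y = 0 := by
    intro y hy
    have hy' : X₁ y = 0 := by simpa using hy
    rw [hf, hy']; simp
  have hl : ∀ y, X₀ y * ℓ y = (f y : ℂ) • ℓ y := by
    intro y
    obtain ⟨K, hK⟩ := aux_factor _ _ (hℓrange y)
    rw [hK, ← Matrix.mul_assoc, (hp y).1, Matrix.smul_mul]
  refine ⟨f, hIcc, hcont, hzero, hl, ?_, ?_⟩
  · intro y
    have h := congrArg Matrix.conjTranspose (hl y)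
    rw [Matrix.conjTranspose_mul, Matrix.conjTranspose_smul, hℓherm, (hherm y).eq] at h
    rw [h, hl y]
    simp
  · rw [continuous_iff_continuousAt]
    intro y
    by_cases hy : X₁ y = 0
    · have hfy : f y = 0 := hzero y (by simpa using hy)
      rw [ContinuousAt, tendsto_iff_norm_sub_tendsto_zero]
      have hlim : Filter.Tendsto (fun z => 4 * Real.pi * ((X₁ z)ᴴ * X₁ z).trace.re)
          (nhds y) (nhds 0) := by
        have := (hsc.const_mul (4 * Real.pi)).tendsto y
        simpa [hy] using this
      refine squeeze_zero (fun _ => norm_nonneg _) (fun z => ?_) hlim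
      have := aux_exp (f z) (hIcc z).1 (hIcc z).2
      rw [(hp z).2] at this
      simpa [hfy] using this
    · have hopen : IsOpen {y | X₁ y ≠ 0} := isOpen_ne_fun hX₁c continuous_const
      have hfc : ContinuousAt f y := hcont.continuousAt (hopen.mem_nhds hy)
      have hg : Continuous fun t : ℝ => Complex.exp (((2 * Real.pi * t : ℝ) : ℂ) * Complex.I) := by
        fun_prop
      exact hg.continuousAt.comp hfc
end

section
/- For θ ∈ ℝ define X₀(θ) = (1/4)·[[3 + cos 2πθ, sin 2πθ],[sin 2πθ, 1 − cos 2πθ]] and X₁(θ) = (1/8)·[[1 − cos 2πθ, √(2(1−cos 2πθ)) − sin 2πθ],[−√(2(1−cos 2πθ)) − sin 2πθ, −1 + cos 2πθ]], matrices in M₂(ℝ) ⊆ M₂(ℂ). Then: (i) for all θ, φ ∈ ℝ, P_I(θ,φ) = exp(−2πiφ)·X₁(θ)ᵀ + X₀(θ) + exp(2πiφ)·X₁(θ), where P_I is the matrix family defined by P_I(θ,φ) = (1/4)·[[4 − (1−cos 2πθ)(1−cos 2πφ), sin(2πθ)(1−cos 2πφ) + i·sin(2πφ)·√(2(1−cos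 2πθ))],[sin(2πθ)(1−cos 2πφ) − i·sin(2πφ)·√(2(1−cos 2πθ)), (1−cos 2πθ)(1−cos 2πφ)]]; (ii) for all θ ∈ ℝ: X₁(θ)² = 0, X₁(θ) = X₀(θ)X₁(θ) + X₁(θ)X₀(θ), X₀(θ) = X₀(θ)² + X₁(θ)ᵀX₁(θ) + X₁(θ)X₁(θ)ᵀ, and tr(X₀(θ)) = 1. -/
open Matrix Real

/-- The projection `P_I` of Theorem 1.6. -/
noncomputable def P_I (θ φ : ℝ) : Matrix (Fin 2) (Fin 2) ℂ :=
  (1 / 4 : ℂ) •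
    !![((4 - (1 - Real.cos (2 * π * θ)) * (1 - Real.cos (2 * π * φ)) : ℝ) : ℂ),
        ((Real.sin (2 * π * θ) * (1 - Real.cos (2 * π * φ)) : ℝ) : ℂ) +
          Complex.I * ((Real.sin (2 * π * φ) * Real.sqrt (2 * (1 - Real.cos (2 * π * θ))) : ℝ) : ℂ);
        ((Real.sin (2 * π * θ) * (1 - Real.cos (2 * π * φ)) : ℝ) : ℂ) -
          Complex.I * ((Real.sin (2 * π * φ) * Real.sqrt (2 * (1 - Real.cos (2 * π * θ))) : ℝ) : ℂ),
        (((1 - Real.cos (2 * π * θ)) * (1 - Real.cos (2 * π * φ)) : ℝ) : ℂ)]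

/-- The matrix `X₀(θ)`, with real entries viewed in `M₂(ℂ)`. -/
noncomputable def X₀ (θ : ℝ) : Matrix (Fin 2) (Fin 2) ℂ :=
  (1 / 4 : ℂ) •
    !![((3 + Real.cos (2 * π * θ) : ℝ) : ℂ), ((Real.sin (2 * π * θ) : ℝ) : ℂ);
        ((Real.sin (2 * π * θ) : ℝ) : ℂ), ((1 - Real.cos (2 * π * θ) : ℝ) : ℂ)]

/-- The matrix `X₁(θ)`, with real entries viewed in `M₂(ℂ)`. -/
noncomputable def X₁ (θ : ℝ) : Matrix (Fin 2) (Fin 2) ℂ :=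
  (1 / 8 : ℂ) •
    !![((1 - Real.cos (2 * π * θ) : ℝ) : ℂ),
        ((Real.sqrt (2 * (1 - Real.cos (2 * π * θ))) - Real.sin (2 * π * θ) : ℝ) : ℂ);
        ((-Real.sqrt (2 * (1 - Real.cos (2 * π * θ))) - Real.sin (2 * π * θ) : ℝ) : ℂ),
        ((-1 + Real.cos (2 * π * θ) : ℝ) : ℂ)]

theorem stmt12 :
    (∀ θ φ : ℝ,
      P_I θ φ =
        Complex.exp (-(((2 * π * φ : ℝ) : ℂ) * Complex.I)) • (X₁ θ)ᵀ + X₀ θ +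
          Complex.exp (((2 * π * φ : ℝ) : ℂ) * Complex.I) • X₁ θ) ∧
    (∀ θ : ℝ,
      X₁ θ * X₁ θ = 0 ∧
      X₁ θ = X₀ θ * X₁ θ + X₁ θ * X₀ θ ∧
      X₀ θ = X₀ θ * X₀ θ + (X₁ θ)ᵀ * X₁ θ + X₁ θ * (X₁ θ)ᵀ ∧
      (X₀ θ).trace = 1) := by
  have key : ∀ θ : ℝ, ∃ c s r : ℂ, c = (Real.cos (2 * π * θ) : ℝ) ∧
      s = (Real.sin (2 * π * θ) : ℝ) ∧
      r = (Real.sqrt (2 * (1 - Real.cos (2 * π * θ))) : ℝ) ∧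
      s ^ 2 = 1 - c ^ 2 ∧ r ^ 2 = 2 * (1 - c) := by
    intro θ
    refine ⟨_, _, _, rfl, rfl, rfl, ?_, ?_⟩
    · have h := Real.sin_sq (2 * π * θ)
      exact_mod_cast h
    · have h := Real.sq_sqrt (show 0 ≤ 2 * (1 - Real.cos (2 * π * θ)) by
        linarith [Real.cos_le_one (2 * π * θ)])
      exact_mod_cast h
  constructor
  · intro θ φ
    have e1 : Complex.exp (((2 * π * φ : ℝ) : ℂ) * Complex.I) =
        (Real.cos (2 * π * φ) : ℝ) + (Real.sin (2 * π * φ) : ℝ) * Complex.I := by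
      rw [Complex.exp_mul_I, Complex.ofReal_cos, Complex.ofReal_sin]
    have e2 : Complex.exp (-(((2 * π * φ : ℝ) : ℂ) * Complex.I)) =
        (Real.cos (2 * π * φ) : ℝ) - (Real.sin (2 * π * φ) : ℝ) * Complex.I := by
      rw [← neg_mul, Complex.exp_mul_I, Complex.ofReal_cos, Complex.ofReal_sin,
        Complex.cos_neg, Complex.sin_neg]
      ring
    rw [e1, e2]
    unfold P_I X₀ X₁
    ext i j
    fin_cases i <;> fin_cases j <;>
      simp [-Complex.ofReal_cos, -Complex.ofReal_sin] <;> ring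
  · intro θ
    obtain ⟨c, s, r, hc, hs, hr, h1, h2⟩ := key θ
    have E0 : X₀ θ = !![(3 + c) / 4, s / 4; s / 4, (1 - c) / 4] := by
      unfold X₀
      ext i j
      fin_cases i <;> fin_cases j <;>
        simp [-Complex.ofReal_cos, -Complex.ofReal_sin, hc, hs] <;> ring
    have E1 : X₁ θ = !![(1 - c) / 8, (r - s) / 8; (-r - s) / 8, (-1 + c) / 8] := by
      unfold X₁
      ext i j
      fin_cases i <;> fin_cases j <;>
        simp [-Complex.ofReal_cos, -Complex.ofReal_sin, hc, hs, hr] <;> ring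
    rw [E0, E1]
    clear hc hs hr E0 E1
    refine ⟨?_, ?_, ?_, ?_⟩
    · ext i j
      fin_cases i <;> fin_cases j <;> simp [Matrix.mul_apply, Fin.sum_univ_two] <;> grind
    · ext i j
      fin_cases i <;> fin_cases j <;> simp [Matrix.mul_apply, Fin.sum_univ_two] <;> grind
    · ext i j
      fin_cases i <;> fin_cases j <;> simp [Matrix.mul_apply, Matrix.vecMul, dotProduct, Fin.sum_univ_two] <;> grind
    · simp [Matrix.trace, Fin.sum_univ_two]
      ring
end

section
/- Assume hypotheses (★). Then B is spectral in C(𝕋ⁿ, ℂ): for every x ∈ B, if ι(x) is invertible in C(𝕋ⁿ, ℂ) then x is invertible in B. -/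
open Filter Topology

/-- The `n`-torus, as the `n`-fold product of the unit circle in `ℂ`. -/
abbrev Torus (n : ℕ) : Type := Fin n → ↥(Metric.sphere (0 : ℂ) 1)

theorem aux_norm (a b : ℂ) (hab : a * b = 1)
    (ht : Tendsto (fun k : ℕ => ((4 * (k : ℂ) ^ 2 - 1)⁻¹) * (a ^ k + b ^ k)) atTop (𝓝 0)) :
    1 ≤ ‖b‖ := by
  by_contra! hb
  have h0 : Tendsto (fun k : ℕ => b ^ k) atTop (𝓝 0) := tendsto_pow_atTop_nhds_zero_of_norm_lt_one hb
  have h2 : Tendsto (fun k : ℕ => (k : ℂ) ^ 2 * b ^ k) atTop (𝓝 0) := by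
    rw [tendsto_zero_iff_norm_tendsto_zero]
    have := tendsto_pow_const_mul_const_pow_of_abs_lt_one 2 (r := ‖b‖) (by simpa using hb)
    simpa using this
  have h3 := (((h2.const_mul 4).sub h0).mul ht).sub (h0.mul h0)
  have h4 : (fun k : ℕ => (4 * ((k : ℂ) ^ 2 * b ^ k) - b ^ k) *
      (((4 * (k : ℂ) ^ 2 - 1)⁻¹) * (a ^ k + b ^ k)) - b ^ k * b ^ k) = fun _ => (1 : ℂ) := by
    funext k
    have hk : (4 * (k : ℂ) ^ 2 - 1) ≠ 0 := by
      intro h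
      have h' : (4 * (k : ℤ) ^ 2 - 1) = 0 := by exact_mod_cast h
      omega
    have hk1 : a ^ k * b ^ k = 1 := by rw [← mul_pow, hab, one_pow]
    have : (4 * ((k : ℂ) ^ 2 * b ^ k) - b ^ k) * (((4 * (k : ℂ) ^ 2 - 1)⁻¹) * (a ^ k + b ^ k))
        = b ^ k * (a ^ k + b ^ k) * ((4 * (k : ℂ) ^ 2 - 1) * (4 * (k : ℂ) ^ 2 - 1)⁻¹) := by ring
    rw [this, mul_inv_cancel₀ hk]
    linear_combination hk1
  rw [h4] at h3
  simpa using tendsto_nhds_unique h3 tendsto_const_nhds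

theorem stmt15 (n : ℕ) (hn : 1 ≤ n)
    {B : Type*} [NormedRing B] [NormedAlgebra ℂ B] [CompleteSpace B]
    (ι : B →ₐ[ℂ] C(Torus n, ℂ)) (hιcont : Continuous ι) (hιinj : Function.Injective ι)
    (u v : Fin n → B)
    (huv : ∀ i, u i * v i = 1) (hvu : ∀ i, v i * u i = 1)
    (hcoord : ∀ (i : Fin n) (x : Torus n), ι (u i) x = (x i : ℂ))
    (hdense : Dense ((Algebra.adjoin ℂ (Set.range u ∪ Set.range v) : Subalgebra ℂ B) : Set B))
    (hseries : ∀ i : Fin n, ∃ l : B,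
      Tendsto (fun N : ℕ => ∑ k ∈ Finset.Icc 1 N, ((4 * (k : ℂ) ^ 2 - 1)⁻¹) • (u i ^ k + v i ^ k))
        atTop (𝓝 l)) :
    ∀ x : B, IsUnit (ι x) → IsUnit x := by
  intro x hx
  by_contra hnu
  have hchar : ∃ f : B →ₐ[ℂ] ℂ, Continuous f ∧ f x = 0 := by
    letI : NormedCommRing B :=
      { (inferInstance : NormedRing B) with
        mul_comm := fun a b => hιinj (by rw [map_mul, map_mul, mul_comm]) }
    obtain ⟨f, hf⟩ := WeakDual.CharacterSpace.exists_apply_eq_zero (A := B) hnu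
    exact ⟨WeakDual.CharacterSpace.toAlgHom f, map_continuous f, hf⟩
  obtain ⟨f, hfc, hfx⟩ := hchar
  have hfuv : ∀ i, f (u i) * f (v i) = 1 := fun i => by rw [← map_mul, huv, map_one]
  have hnorm : ∀ i, ‖f (u i)‖ = 1 := by
    intro i
    obtain ⟨l, hl⟩ := hseries i
    have hl' := (hfc.tendsto l).comp hl
    have hd := ((tendsto_add_atTop_iff_nat 1).2 hl').sub hl'
    rw [sub_self] at hd
    have ht : Tendsto (fun k : ℕ => ((4 * (k : ℂ) ^ 2 - 1)⁻¹) * (f (u i) ^ k + f (v i) ^ k))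
        atTop (𝓝 0) := by
      rw [← tendsto_add_atTop_iff_nat 1]
      refine hd.congr fun N => ?_
      simp only [Function.comp]
      rw [Finset.sum_Icc_succ_top (by omega), map_add, add_sub_cancel_left]
      simp [mul_add]
    have h1 := aux_norm _ _ (hfuv i) ht
    have h2 := aux_norm _ _ ((mul_comm _ _).trans (hfuv i)) (by simpa only [add_comm] using ht)
    have h3 : ‖f (u i)‖ * ‖f (v i)‖ = 1 := by rw [← norm_mul, hfuv, norm_one]
    nlinarith
  let p : Torus n := fun i => ⟨f (u i), by simpa using hnorm i⟩
  have hu : ∀ i, ι (u i) p = f (u i) := fun i => hcoord i p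
  have hv : ∀ i, ι (v i) p = f (v i) := by
    intro i
    have h1 : ι (u i) p * ι (v i) p = 1 := by
      rw [← ContinuousMap.mul_apply, ← map_mul, huv, map_one, ContinuousMap.one_apply]
    rw [hu, ← hfuv i] at h1
    exact mul_left_cancel₀ (left_ne_zero_of_mul_eq_one (hfuv i)) h1
  have heq : (fun y => ι y p) = (fun y => f y) := by
    refine Continuous.ext_on hdense ((continuous_eval_const p).comp hιcont) hfc ?_
    intro y hy
    induction hy using Algebra.adjoin_induction with
    | mem y hy =>
      rcases hy with ⟨i, rfl⟩ | ⟨i, rfl⟩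
      · exact hu i
      · exact hv i
    | algebraMap r => simp
    | add a b _ _ ha hb => simp_all
    | mul a b _ _ ha hb => simp_all
  obtain ⟨w, hw⟩ := hx.exists_right_inv
  have h1 : ι x p * w p = 1 := by rw [← ContinuousMap.mul_apply, hw, ContinuousMap.one_apply]
  rw [congrFun heq x, hfx, zero_mul] at h1
  exact zero_ne_one h1
end

section
/- Let n ≥ 1, let B be a complex unital Banach algebra, let ι : B → C(𝕋ⁿ, ℂ) be a continuous unital ℂ-algebra homomorphism, and let u be an invertible element of B with ι(u) equal to the i-th coordinate function x ↦ xᵢ for some i. If the series Σ_{k=1}^∞ (uᵏ + u⁻ᵏ)/(4k² − 1) converges in B, then the spectrum of u in B is exactly the unit circle {z ∈ ℂ : |z| = 1}; in particular the spectral radii of u and of u⁻¹ in B are both equal to 1. -/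
open Filter Topology

/-- If `z` is in the spectrum of `u` and `u⁻¹ = v`, then `z ^ k + z⁻¹ ^ k` is in the spectrum
of `u ^ k + v ^ k`. -/
theorem aux_mem {B : Type*} [NormedRing B] [NormedAlgebra ℂ B] [CompleteSpace B]
    (u v : B) (huv : u * v = 1) (hvu : v * u = 1) (z : ℂ) (hz0 : z ≠ 0)
    (hz : z ∈ spectrum ℂ u) (k : ℕ) :
    z ^ k + z⁻¹ ^ k ∈ spectrum ℂ (u ^ k + v ^ k) := by
  have h1 : z ^ k ∈ spectrum ℂ (u ^ k) := spectrum.pow_mem_pow u k hz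
  have hc : Commute u v := by rw [Commute, SemiconjBy, huv, hvu]
  have hab : u ^ k * v ^ k = 1 := by rw [← hc.mul_pow, huv, one_pow]
  have hba : v ^ k * u ^ k = 1 := by rw [← hc.symm.mul_pow, hvu, one_pow]
  have hm : z⁻¹ ^ k * z ^ k = 1 := by rw [← mul_pow, inv_mul_cancel₀ hz0, one_pow]
  generalize u ^ k = a at *
  generalize v ^ k = b at *
  generalize z ^ k = s at *
  generalize z⁻¹ ^ k = t at *
  rw [spectrum.mem_iff] at h1 ⊢
  intro hU
  apply h1
  have hts : algebraMap ℂ B s * algebraMap ℂ B t = 1 := by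
    rw [← map_mul, mul_comm, hm, map_one]
  have e1 : algebraMap ℂ B (s + t) - (a + b)
      = (algebraMap ℂ B s - a) * (1 - algebraMap ℂ B t * b) := by
    have h2 : a * (algebraMap ℂ B t * b) = algebraMap ℂ B t := by
      rw [← mul_assoc, ← Algebra.commutes t a, mul_assoc, hab, mul_one]
    rw [map_add, sub_mul, mul_sub, mul_sub, h2, ← mul_assoc, hts]
    simp only [mul_one, one_mul]
    abel
  have hcomm : Commute (algebraMap ℂ B s - a) (1 - algebraMap ℂ B t * b) := by
    have hab' : Commute a b := by rw [Commute, SemiconjBy, hab, hba]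
    refine Commute.sub_left (Algebra.commute_algebraMap_left s _) ?_
    refine Commute.sub_right (Commute.one_right a) ?_
    exact (Algebra.commute_algebraMap_right t a).mul_right hab'
  rw [e1, hcomm.isUnit_mul_iff] at hU
  exact hU.1

theorem aux_growth (r C : ℝ) (hr : 1 < r)
    (h : ∀ᶠ k : ℕ in atTop, r ^ k - 1 ≤ C * (k : ℝ) ^ 2) : False := by
  have t1 := (tendsto_pow_const_div_const_pow_of_one_lt 2 hr).const_mul C
  have t2 := (tendsto_pow_const_div_const_pow_of_one_lt 0 hr)
  have t3 := t1.add t2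
  simp only [mul_zero, add_zero, pow_zero] at t3
  have e := t3.eventually (gt_mem_nhds (zero_lt_one))
  obtain ⟨k, hk, hk'⟩ := (h.and e).exists
  have hp : 0 < r ^ k := by positivity
  rw [← mul_div_assoc, ← add_div, div_lt_one hp] at hk'
  linarith

theorem aux_sub {B : Type*} [NormedRing B] [NormedAlgebra ℂ B] [CompleteSpace B]
    (u v : B) (huv : u * v = 1) (hvu : v * u = 1)
    (hb : ∀ᶠ k : ℕ in atTop, ‖u ^ k + v ^ k‖ ≤ 4 * (k : ℝ) ^ 2)
    (z : ℂ) (hz : z ∈ spectrum ℂ u) : ‖z‖ = 1 := by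
  have hz0 : z ≠ 0 := by
    rintro rfl
    exact spectrum.zero_notMem ℂ (⟨⟨u, v, huv, hvu⟩, rfl⟩ : IsUnit u) hz
  have hb' : ∀ᶠ k : ℕ in atTop, ‖z ^ k + z⁻¹ ^ k‖ ≤ (4 * ‖(1 : B)‖) * (k : ℝ) ^ 2 := by
    filter_upwards [hb] with k hk
    have := spectrum.norm_le_norm_mul_of_mem (aux_mem u v huv hvu z hz0 hz k)
    nlinarith [norm_nonneg (1 : B)]
  rcases lt_trichotomy ‖z‖ 1 with h | h | h
  · exfalso
    have hr : 1 < ‖z⁻¹‖ := by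
      rw [norm_inv]; exact (one_lt_inv₀ (norm_pos_iff.2 hz0)).2 h
    refine aux_growth _ (4 * ‖(1 : B)‖) hr ?_
    filter_upwards [hb'] with k hk
    have h1 : ‖z ^ k‖ ≤ 1 := by rw [norm_pow]; exact pow_le_one₀ (norm_nonneg _) h.le
    have h2 := norm_sub_le (z ^ k + z⁻¹ ^ k) (z ^ k)
    rw [add_sub_cancel_left, norm_pow z⁻¹] at h2
    linarith
  · exact h
  · exfalso
    have hr : ‖z⁻¹‖ ≤ 1 := by
      rw [norm_inv]; exact inv_le_one_of_one_le₀ h.le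
    refine aux_growth _ (4 * ‖(1 : B)‖) h ?_
    filter_upwards [hb'] with k hk
    have h1 : ‖z⁻¹ ^ k‖ ≤ 1 := by rw [norm_pow]; exact pow_le_one₀ (norm_nonneg _) hr
    have h2 := norm_sub_le (z ^ k + z⁻¹ ^ k) (z⁻¹ ^ k)
    rw [add_sub_cancel_right, norm_pow z] at h2
    linarith

theorem aux_radius {B : Type*} [NormedRing B] [NormedAlgebra ℂ B]
    (u : B) (h : spectrum ℂ u = {z : ℂ | ‖z‖ = 1}) : spectralRadius ℂ u = 1 := by
  rw [spectralRadius, h]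
  apply le_antisymm
  · refine iSup₂_le fun z hz => ?_
    have : ‖z‖₊ = 1 := by ext; exact hz
    simp [this]
  · refine le_iSup₂_of_le (1 : ℂ) (by simp) (by simp)

theorem aux_eval {B : Type*} [NormedRing B] [NormedAlgebra ℂ B] (n : ℕ)
    (ι : B →ₐ[ℂ] C(Torus n, ℂ)) (w : B) (x : Torus n) : ι w x ∈ spectrum ℂ w := by
  rw [spectrum.mem_iff]
  intro hU
  have h2 := (hU.map ι).map (ContinuousMap.evalAlgHom ℂ ℂ x)
  rw [map_sub, AlgHom.commutes] at h2
  simp at h2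

theorem stmt16 (n : ℕ) (hn : 1 ≤ n)
    {B : Type*} [NormedRing B] [NormedAlgebra ℂ B] [CompleteSpace B]
    (ι : B →ₐ[ℂ] C(Torus n, ℂ)) (hιcont : Continuous ι)
    (u v : B) (huv : u * v = 1) (hvu : v * u = 1) (i : Fin n)
    (hcoord : ∀ x : Torus n, ι u x = (x i : ℂ))
    (hseries : ∃ l : B,
      Tendsto (fun N : ℕ => ∑ k ∈ Finset.Icc 1 N, ((4 * (k : ℂ) ^ 2 - 1)⁻¹) • (u ^ k + v ^ k))
        atTop (𝓝 l)) :
    spectrum ℂ u = {z : ℂ | ‖z‖ = 1} ∧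
    spectralRadius ℂ u = 1 ∧ spectralRadius ℂ v = 1 := by
  obtain ⟨l, hl⟩ := hseries
  have hb : ∀ᶠ k : ℕ in atTop, ‖u ^ k + v ^ k‖ ≤ 4 * (k : ℝ) ^ 2 := by
    have h1 := ((tendsto_add_atTop_iff_nat 1).2 hl).sub hl
    rw [sub_self] at h1
    have h2 := h1.norm
    rw [norm_zero] at h2
    have h3 := h2.eventually (gt_mem_nhds zero_lt_one)
    obtain ⟨M, hM⟩ := eventually_atTop.1 h3
    refine eventually_atTop.2 ⟨M + 1, fun k hk => ?_⟩
    obtain ⟨m, rfl⟩ : ∃ m, k = m + 1 := ⟨k - 1, by omega⟩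
    have h4 := hM m (by omega)
    rw [Finset.sum_Icc_succ_top (by omega), add_sub_cancel_left, norm_smul, norm_inv] at h4
    have hm : (0 : ℝ) ≤ m := Nat.cast_nonneg m
    have hpos : (0 : ℝ) < 4 * ((m + 1 : ℕ) : ℝ) ^ 2 - 1 := by
      push_cast; nlinarith
    have h5 : ‖(4 * ((m + 1 : ℕ) : ℂ) ^ 2 - 1)‖ = 4 * ((m + 1 : ℕ) : ℝ) ^ 2 - 1 := by
      have : (4 * ((m + 1 : ℕ) : ℂ) ^ 2 - 1)
          = ((4 * ((m + 1 : ℕ) : ℝ) ^ 2 - 1 : ℝ) : ℂ) := by push_cast; ring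
      rw [this, Complex.norm_real, Real.norm_of_nonneg hpos.le]
    rw [h5, inv_mul_lt_iff₀ hpos] at h4
    linarith
  have hu : spectrum ℂ u = {z : ℂ | ‖z‖ = 1} := by
    ext z
    refine ⟨aux_sub u v huv hvu hb z, fun hz => ?_⟩
    have := aux_eval n ι u (fun _ => ⟨z, by simpa using hz⟩)
    rwa [hcoord] at this
  have hv : spectrum ℂ v = {z : ℂ | ‖z‖ = 1} := by
    ext z
    refine ⟨aux_sub v u hvu huv (by simpa only [add_comm] using hb) z, fun hz => ?_⟩
    have hz' : ‖z‖ = 1 := hz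
    have hz0 : z ≠ 0 := by rintro rfl; simp at hz'
    set x : Torus n := fun _ => ⟨z⁻¹, by simp [hz']⟩ with hx
    have h1 := aux_eval n ι v x
    have h2 : ι u x * ι v x = 1 := by
      rw [← ContinuousMap.mul_apply, ← map_mul, huv, map_one]; rfl
    rw [hcoord] at h2
    have h3 : ι v x = z := by
      have h4 : z⁻¹ * ι v x = 1 := h2
      field_simp at h4
      exact h4
    rwa [h3] at h1
  exact ⟨hu, aux_radius u hu, aux_radius v hv⟩
end

section
/- Assume hypotheses (★). Then every character of B is given by evaluation at a point of 𝕋ⁿ: for every nonzero continuous ℂ-algebra homomorphism χ : B → ℂ, there exists a point x ∈ 𝕋ⁿ such that χ(b) = ι(b)(x) for all b ∈ B. -/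
open Filter Topology

theorem aux_norm_le (z w : ℂ) (h : z * w = 1)
    (ht : Tendsto (fun k : ℕ => (4 * (k : ℂ) ^ 2 - 1)⁻¹ * (z ^ k + w ^ k)) atTop (𝓝 0)) :
    ‖z‖ ≤ 1 := by
  by_contra! hz
  have hn : ‖z‖ * ‖w‖ = 1 := by rw [← norm_mul, h, norm_one]
  have hw : ‖w‖ < 1 := by
    by_contra! hw
    nlinarith
  have hne : ∀ k : ℕ, (4 * (k : ℂ) ^ 2 - 1) ≠ 0 := by
    intro k hk
    have h1 : ((4 * (k : ℤ) ^ 2 - 1 : ℤ) : ℂ) = 0 := by push_cast; exact hk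
    have h2 : (4 * (k : ℤ) ^ 2 - 1 : ℤ) = 0 := by exact_mod_cast h1
    omega
  have h0 : Tendsto (fun k : ℕ => w ^ k) atTop (𝓝 0) :=
    tendsto_pow_atTop_nhds_zero_of_norm_lt_one hw
  have h2 : Tendsto (fun k : ℕ => (k : ℂ) ^ 2 * w ^ k) atTop (𝓝 0) :=
    (summable_pow_mul_geometric_of_norm_lt_one 2 hw).tendsto_atTop_zero
  have h3 : Tendsto (fun k : ℕ => 4 * ((k : ℂ) ^ 2 * w ^ k) - w ^ k) atTop (𝓝 (4 * 0 - 0)) :=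
    (h2.const_mul 4).sub h0
  have h4 := ht.mul h3
  have h5 : Tendsto (fun k : ℕ => 1 + w ^ k * w ^ k) atTop (𝓝 (1 + 0 * 0)) :=
    (h0.mul h0).const_add 1
  have h6 : (fun k : ℕ => (4 * (k : ℂ) ^ 2 - 1)⁻¹ * (z ^ k + w ^ k) *
      (4 * ((k : ℂ) ^ 2 * w ^ k) - w ^ k)) = fun k : ℕ => 1 + w ^ k * w ^ k := by
    funext k
    have hk : z ^ k * w ^ k = 1 := by rw [← mul_pow, h, one_pow]
    calc _ = ((4 * (k : ℂ) ^ 2 - 1)⁻¹ * (4 * (k : ℂ) ^ 2 - 1)) *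
          (z ^ k * w ^ k + w ^ k * w ^ k) := by ring
      _ = _ := by rw [inv_mul_cancel₀ (hne k), hk, one_mul]
  rw [h6] at h4
  have := tendsto_nhds_unique h4 h5
  norm_num at this

theorem stmt17 (n : ℕ) (hn : 1 ≤ n)
    {B : Type*} [NormedRing B] [NormedAlgebra ℂ B] [CompleteSpace B]
    (ι : B →ₐ[ℂ] C(Torus n, ℂ)) (hιcont : Continuous ι) (hιinj : Function.Injective ι)
    (u v : Fin n → B)
    (huv : ∀ i, u i * v i = 1) (hvu : ∀ i, v i * u i = 1)
    (hcoord : ∀ (i : Fin n) (x : Torus n), ι (u i) x = (x i : ℂ))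
    (hdense : Dense ((Algebra.adjoin ℂ (Set.range u ∪ Set.range v) : Subalgebra ℂ B) : Set B))
    (hseries : ∀ i : Fin n, ∃ l : B,
      Tendsto (fun N : ℕ => ∑ k ∈ Finset.Icc 1 N, ((4 * (k : ℂ) ^ 2 - 1)⁻¹) • (u i ^ k + v i ^ k))
        atTop (𝓝 l)) :
    ∀ χ : B →ₐ[ℂ] ℂ, Continuous χ → ∃ x : Torus n, ∀ b : B, χ b = ι b x := by
  intro χ hχ
  have hzw : ∀ i, χ (u i) * χ (v i) = 1 := fun i => by rw [← map_mul, huv, map_one]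
  have ht : ∀ i, Tendsto (fun k : ℕ => (4 * (k : ℂ) ^ 2 - 1)⁻¹ *
      (χ (u i) ^ k + χ (v i) ^ k)) atTop (𝓝 0) := by
    intro i
    obtain ⟨l, hl⟩ := hseries i
    have h1 := (hχ.tendsto l).comp hl
    have h2 := (h1.comp (tendsto_add_atTop_nat 1)).sub h1
    rw [sub_self] at h2
    rw [← tendsto_add_atTop_iff_nat 1]
    refine h2.congr fun N => ?_
    simp only [Function.comp_apply]
    rw [Finset.sum_Icc_succ_top (by omega), map_add, add_sub_cancel_left]
    simp only [map_smul, map_add, map_pow, smul_eq_mul]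
  have hnorm : ∀ i, ‖χ (u i)‖ = 1 := by
    intro i
    have h1 := aux_norm_le _ _ (hzw i) (ht i)
    have h2 := aux_norm_le (χ (v i)) (χ (u i)) (by rw [mul_comm, hzw])
      ((ht i).congr fun k => by rw [add_comm (χ (u i) ^ k)])
    have hn : ‖χ (u i)‖ * ‖χ (v i)‖ = 1 := by rw [← norm_mul, hzw, norm_one]
    nlinarith [norm_nonneg (χ (u i)), norm_nonneg (χ (v i))]
  let x : Torus n := fun i => ⟨χ (u i), by simp [hnorm i]⟩
  refine ⟨x, ?_⟩
  have hcu : ∀ i, χ (u i) = ι (u i) x := fun i => by rw [hcoord]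
  have hcv : ∀ i, χ (v i) = ι (v i) x := by
    intro i
    have h1 : ι (u i) x * ι (v i) x = 1 := by
      rw [← ContinuousMap.mul_apply, ← map_mul, huv, map_one, ContinuousMap.one_apply]
    have h2 := hzw i
    rw [hcu] at h2
    exact mul_left_cancel₀ (left_ne_zero_of_mul_eq_one h1) (h2.trans h1.symm)
  have hc : Continuous fun b => ι b x := (continuous_eval_const x).comp hιcont
  have key : (χ : B → ℂ) = fun b => ι b x := by
    refine Continuous.ext_on hdense hχ hc ?_
    intro b hb
    change χ b = ι b x
    induction hb using Algebra.adjoin_induction with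
    | mem b hb =>
      rcases hb with ⟨i, rfl⟩ | ⟨i, rfl⟩
      · exact hcu i
      · exact hcv i
    | algebraMap r => simp [AlgHom.commutes]
    | add a b _ _ ha hb => rw [map_add, map_add, ContinuousMap.add_apply, ha, hb]
    | mul a b _ _ ha hb => rw [map_mul, map_mul, ContinuousMap.mul_apply, ha, hb]
  exact fun b => congrFun key b
end

section
/- There is no continuously differentiable function g : ℝ → ℂ which is periodic with period 1 and satisfies g(θ)² = 2 − 2cos(2πθ) for all θ ∈ ℝ. (Equivalently, the element 2 − s − s* of the Banach algebra C¹(S¹) of continuously differentiable functions on the circle, where s(θ) = exp(2πiθ), has no square root in C¹(S¹).) -/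
theorem stmt18 :
    ¬ ∃ g : ℝ → ℂ,
        (Differentiable ℝ g ∧ Continuous (deriv g)) ∧
        Function.Periodic g 1 ∧
        ∀ θ : ℝ, (g θ) ^ 2 = 2 - 2 * Real.cos (2 * Real.pi * θ) := by
  rintro ⟨g, ⟨hd, -⟩, hp, hg⟩
  let f : ℝ → ℂ := fun θ => ((2 * Real.sin (Real.pi * θ) : ℝ) : ℂ)
  have hfg : ∀ θ, g θ ^ 2 = f θ ^ 2 := by
    intro θ
    rw [hg]
    have : (2 - 2 * Real.cos (2 * Real.pi * θ) : ℝ) = (2 * Real.sin (Real.pi * θ)) ^ 2 := by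
      rw [mul_assoc 2 Real.pi θ, Real.cos_two_mul, mul_pow, Real.sin_sq]
      ring
    simp only [f]
    rw [← Complex.ofReal_pow, ← this]
    push_cast
    ring
  have hfd : ∀ θ, HasDerivAt f ((2 * (Real.cos (Real.pi * θ) * Real.pi) : ℝ) : ℂ) θ := by
    intro θ
    have h1 : HasDerivAt (fun x : ℝ => Real.pi * x) Real.pi θ := by
      simpa using (hasDerivAt_id θ).const_mul Real.pi
    exact (h1.sin.const_mul 2).ofReal_comp
  have hfc : Continuous f := by fun_prop
  have key : ∃ c : ℂ, c ≠ 0 ∧ Set.EqOn g (fun θ => c * f θ) (Set.Ioo 0 1) := by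
    rcases isPreconnected_Ioo.eq_or_eq_neg_of_sq_eq (S := Set.Ioo (0:ℝ) 1)
      hd.continuous.continuousOn hfc.continuousOn (fun θ _ => hfg θ) (by
        intro θ hθ
        have : 0 < Real.sin (Real.pi * θ) := by
          apply Real.sin_pos_of_pos_of_lt_pi
          · exact mul_pos Real.pi_pos hθ.1
          · nlinarith [Real.pi_pos, hθ.2]
        simp only [f]
        exact_mod_cast (by positivity : 2 * Real.sin (Real.pi * θ) ≠ 0)) with h | h
    · exact ⟨1, one_ne_zero, fun θ hθ => by simpa using h hθ⟩
    · exact ⟨-1, by simp, fun θ hθ => by simpa using h hθ⟩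
  obtain ⟨c, hc, h⟩ := key
  have h' : Set.EqOn g (fun θ => c * f θ) (Set.Icc 0 1) := by
    have := h.closure hd.continuous (continuous_const.mul hfc)
    rwa [closure_Ioo (by norm_num)] at this
  have hder : ∀ θ ∈ Set.Icc (0:ℝ) 1,
      deriv g θ = c * ((2 * (Real.cos (Real.pi * θ) * Real.pi) : ℝ) : ℂ) := by
    intro θ hθ
    have a := (hd θ).hasDerivAt.hasDerivWithinAt (s := Set.Icc 0 1)
    have b := (((hfd θ).const_mul c).hasDerivWithinAt (s := Set.Icc 0 1)).congr h' (h' hθ)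
    exact (uniqueDiffOn_Icc (by norm_num) θ hθ).eq_deriv _ a b
  have hper : deriv g 1 = deriv g 0 := by
    have h2 : deriv (fun x => g (x + 1)) 0 = deriv g (0 + 1) := deriv_comp_add_const ..
    rw [zero_add] at h2
    rw [← h2]
    congr 1
    exact funext hp
  rw [hder 1 (by simp), hder 0 (by simp)] at hper
  have h3 := Complex.ofReal_injective (mul_left_cancel₀ hc hper)
  simp at h3
  linarith [Real.pi_pos]
end
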